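/- arXiv:1806.02331 — 2 statements merged into one kernel-verified Lean document; each statement's English description precedes it below -/
import Mathlib

section
/- Let ι_{a1}, ι_{a2}, ι_{b1}, ι_{b2}, ι_e be nonempty finite types and let ρ be a pure density matrix on the product type ι_{a1} × ι_{a2} × ι_{b1} × ι_{b2} × ι_e. Assume the reduced density matrix ρ^{a1 a2 b2} equals the tensor (Kronecker) product ρ^{a1 b2} ⊗ ρ^{a2} (after the obvious reindexing of product types). Then the following exact entropy identity holds: S(ρ^{a1 a2 b1 b2}) = S(ρ^{a1 b2}) + S(ρ^{a2}) + S(ρ^{e}) − S(ρ^{b1 e}). -/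
open Matrix ComplexOrder

/-- Von Neumann entropy of a (Hermitian) matrix: `∑ i, negMulLog λᵢ` over its eigenvalues. -/
noncomputable def vnEntropy {ι : Type*} [Fintype ι] [DecidableEq ι] (M : Matrix ι ι ℂ) : ℝ :=
  if h : M.IsHermitian then ∑ i, Real.negMulLog (h.eigenvalues i) else 0

/-- A density matrix: positive semidefinite with unit trace. -/
def IsDensityMatrix {ι : Type*} [Fintype ι] (ρ : Matrix ι ι ℂ) : Prop :=
  ρ.PosSemidef ∧ ρ.trace = 1

/-- A pure density matrix: a density matrix of the form `|w⟩⟨w|` for a unit vector `w`. -/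
def IsPureDensityMatrix {ι : Type*} [Fintype ι] (ρ : Matrix ι ι ℂ) : Prop :=
  IsDensityMatrix ρ ∧ ∃ w : ι → ℂ, (∑ i, ‖w i‖ ^ 2 = 1) ∧ ρ = Matrix.vecMulVec w (star w)

section
/- Index types: positions are (a1, a2, b1, b2, e). -/
variable {ι1 ι2 ι3 ι4 ιe : Type*}
  [Fintype ι1] [Fintype ι2] [Fintype ι3] [Fintype ι4] [Fintype ιe]

/-- Reduced density matrix on (a1, a2, b1, b2). -/
noncomputable def redA1A2B1B2
    (ρ : Matrix (ι1 × ι2 × ι3 × ι4 × ιe) (ι1 × ι2 × ι3 × ι4 × ιe) ℂ) :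
    Matrix (ι1 × ι2 × ι3 × ι4) (ι1 × ι2 × ι3 × ι4) ℂ :=
  fun p q => ∑ xe : ιe,
    ρ (p.1, p.2.1, p.2.2.1, p.2.2.2, xe) (q.1, q.2.1, q.2.2.1, q.2.2.2, xe)

/-- Reduced density matrix on (a1, a2, b2). -/
noncomputable def redA1A2B2
    (ρ : Matrix (ι1 × ι2 × ι3 × ι4 × ιe) (ι1 × ι2 × ι3 × ι4 × ιe) ℂ) :
    Matrix (ι1 × ι2 × ι4) (ι1 × ι2 × ι4) ℂ :=
  fun p q => ∑ x3 : ι3, ∑ xe : ιe,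
    ρ (p.1, p.2.1, x3, p.2.2, xe) (q.1, q.2.1, x3, q.2.2, xe)

/-- Reduced density matrix on (a1, b2). -/
noncomputable def redA1B2
    (ρ : Matrix (ι1 × ι2 × ι3 × ι4 × ιe) (ι1 × ι2 × ι3 × ι4 × ιe) ℂ) :
    Matrix (ι1 × ι4) (ι1 × ι4) ℂ :=
  fun p q => ∑ x2 : ι2, ∑ x3 : ι3, ∑ xe : ιe,
    ρ (p.1, x2, x3, p.2, xe) (q.1, x2, x3, q.2, xe)

/-- Reduced density matrix on (a2). -/
noncomputable def redA2
    (ρ : Matrix (ι1 × ι2 × ι3 × ι4 × ιe) (ι1 × ι2 × ι3 × ι4 × ιe) ℂ) :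
    Matrix ι2 ι2 ℂ :=
  fun p q => ∑ x1 : ι1, ∑ x3 : ι3, ∑ x4 : ι4, ∑ xe : ιe,
    ρ (x1, p, x3, x4, xe) (x1, q, x3, x4, xe)

/-- Reduced density matrix on (e). -/
noncomputable def redE
    (ρ : Matrix (ι1 × ι2 × ι3 × ι4 × ιe) (ι1 × ι2 × ι3 × ι4 × ιe) ℂ) :
    Matrix ιe ιe ℂ :=
  fun p q => ∑ x1 : ι1, ∑ x2 : ι2, ∑ x3 : ι3, ∑ x4 : ι4,
    ρ (x1, x2, x3, x4, p) (x1, x2, x3, x4, q)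

/-- Reduced density matrix on (b1, e). -/
noncomputable def redB1E
    (ρ : Matrix (ι1 × ι2 × ι3 × ι4 × ιe) (ι1 × ι2 × ι3 × ι4 × ιe) ℂ) :
    Matrix (ι3 × ιe) (ι3 × ιe) ℂ :=
  fun p q => ∑ x1 : ι1, ∑ x2 : ι2, ∑ x4 : ι4,
    ρ (x1, x2, p.1, x4, p.2) (x1, x2, q.1, x4, q.2)

end

lemma vnEntropy_eq_roots {m : Type*} [Fintype m] [DecidableEq m] (M : Matrix m m ℂ)
    (h : M.IsHermitian) :
    vnEntropy M = (M.charpoly.roots.map (fun z => Real.negMulLog z.re)).sum := by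
  rw [vnEntropy, dif_pos h, h.roots_charpoly_eq_eigenvalues, Multiset.map_map]
  simp [Function.comp_def]

lemma vnEntropy_complement {m n : Type*} [Fintype m] [DecidableEq m] [Fintype n] [DecidableEq n]
    (A : Matrix m n ℂ) : vnEntropy (A * Aᴴ) = vnEntropy ((Aᴴ * A)ᵀ) := by
  rw [vnEntropy_eq_roots _ (isHermitian_mul_conjTranspose_self A),
    vnEntropy_eq_roots _ (isHermitian_conjTranspose_mul_self A).transpose, charpoly_transpose]
  have h := congrArg Polynomial.roots (charpoly_mul_comm' A Aᴴ)
  rw [Polynomial.roots_mul (mul_ne_zero (pow_ne_zero _ Polynomial.X_ne_zero)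
      (charpoly_monic _).ne_zero),
    Polynomial.roots_mul (mul_ne_zero (pow_ne_zero _ Polynomial.X_ne_zero)
      (charpoly_monic _).ne_zero)] at h
  have h2 := congrArg (fun s => (Multiset.map (fun z : ℂ => Real.negMulLog z.re) s).sum) h
  simpa [Multiset.map_nsmul, Multiset.sum_nsmul] using h2

lemma charpoly_kronecker {m n : Type*} [Fintype m] [DecidableEq m] [Fintype n] [DecidableEq n]
    (M : Matrix m m ℂ) (N : Matrix n n ℂ) (hM : M.IsHermitian) (hN : N.IsHermitian) :
    (kroneckerMap (· * ·) M N).charpoly = ∏ p : m × n,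
      (Polynomial.X - Polynomial.C ((hM.eigenvalues p.1 * hN.eigenvalues p.2 : ℝ) : ℂ)) := by
  have eM := hM.spectral_theorem
  have eN := hN.spectral_theorem
  rw [Unitary.conjStarAlgAut_apply] at eM eN
  conv_lhs => rw [eM, eN]
  rw [mul_kronecker_mul, mul_kronecker_mul, charpoly_mul_comm, ← mul_assoc, ← mul_kronecker_mul]
  simp [diagonal_kronecker_diagonal, charpoly_diagonal]

lemma vnEntropy_kronecker {m n : Type*} [Fintype m] [DecidableEq m] [Fintype n] [DecidableEq n]
    (M : Matrix m m ℂ) (N : Matrix n n ℂ) (hM : M.IsHermitian) (hN : N.IsHermitian)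
    (tM : M.trace = 1) (tN : N.trace = 1) :
    vnEntropy (kroneckerMap (· * ·) M N) = vnEntropy M + vnEntropy N := by
  have hK : (kroneckerMap (· * ·) M N).IsHermitian := by
    unfold Matrix.IsHermitian
    rw [conjTranspose_kronecker, hM.eq, hN.eq]
  rw [vnEntropy_eq_roots _ hK, charpoly_kronecker M N hM hN, Polynomial.roots_prod _ _ (by
    simp only [Finset.prod_ne_zero_iff]
    intro p _
    exact Polynomial.X_sub_C_ne_zero _)]
  rw [vnEntropy, dif_pos hM, vnEntropy, dif_pos hN]
  have sM : ∑ i, hM.eigenvalues i = 1 := by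
    have := hM.trace_eq_sum_eigenvalues
    rw [tM] at this
    exact Complex.ofReal_injective (by simpa using this.symm)
  have sN : ∑ i, hN.eigenvalues i = 1 := by
    have := hN.trace_eq_sum_eigenvalues
    rw [tN] at this
    exact Complex.ofReal_injective (by simpa using this.symm)
  simp only [Polynomial.roots_X_sub_C, Multiset.bind_singleton, Multiset.map_map,
    Function.comp_def, Complex.ofReal_re]
  change ∑ p : m × n, Real.negMulLog (hM.eigenvalues p.1 * hN.eigenvalues p.2) = _
  simp only [Real.negMulLog_mul, Finset.sum_add_distrib, Fintype.sum_prod_type]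
  simp only [← Finset.mul_sum, ← Finset.sum_mul, sM, sN, one_mul]

lemma vnEntropy_reindex {m n : Type*} [Fintype m] [DecidableEq m] [Fintype n] [DecidableEq n]
    (e : m ≃ n) (M : Matrix m m ℂ) (hM : M.IsHermitian) :
    vnEntropy (M.submatrix e.symm e.symm) = vnEntropy M := by
  rw [vnEntropy_eq_roots _ hM, vnEntropy_eq_roots _ (hM.submatrix _)]
  have := charpoly_reindex e M
  rw [reindex_apply] at this
  rw [this]

/-- **First (equality) stage of the proof of Theorem 2 of the paper.** For a pure density
matrix `ρ` on `a1 × a2 × b1 × b2 × e` satisfying the process-matrix normalization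
constraint `ρ^{a1 a2 b2} = ρ^{a1 b2} ⊗ ρ^{a2}`, one has the exact entropy identity
`S(ρ^{a1 a2 b1 b2}) = S(ρ^{a1 b2}) + S(ρ^{a2}) + S(ρ^{e}) − S(ρ^{b1 e})`. -/
theorem entropy_identity_of_normalization
    {ι1 ι2 ι3 ι4 ιe : Type*}
    [Fintype ι1] [Fintype ι2] [Fintype ι3] [Fintype ι4] [Fintype ιe]
    [DecidableEq ι1] [DecidableEq ι2] [DecidableEq ι3] [DecidableEq ι4] [DecidableEq ιe]
    [Nonempty ι1] [Nonempty ι2] [Nonempty ι3] [Nonempty ι4] [Nonempty ιe]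
    (ρ : Matrix (ι1 × ι2 × ι3 × ι4 × ιe) (ι1 × ι2 × ι3 × ι4 × ιe) ℂ)
    (hpure : IsPureDensityMatrix ρ)
    (hfact : ∀ (x1 y1 : ι1) (x2 y2 : ι2) (x4 y4 : ι4),
      redA1A2B2 ρ (x1, x2, x4) (y1, y2, y4)
        = redA1B2 ρ (x1, x4) (y1, y4) * redA2 ρ x2 y2) :
    vnEntropy (redA1A2B1B2 ρ)
      = vnEntropy (redA1B2 ρ) + vnEntropy (redA2 ρ)
        + vnEntropy (redE ρ) - vnEntropy (redB1E ρ) := by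
  obtain ⟨⟨hpos, htr⟩, w, -, hw⟩ := hpure
  have hH : ∀ p q, star (ρ p q) = ρ q p := fun p q => hpos.isHermitian.apply q p
  -- complementary subsystems: `a1 a2 b1 b2` and `e`
  have h1 : vnEntropy (redA1A2B1B2 ρ) = vnEntropy (redE ρ) := by
    let A : Matrix (ι1 × ι2 × ι3 × ι4) ιe ℂ :=
      Matrix.of fun p x => w (p.1, p.2.1, p.2.2.1, p.2.2.2, x)
    have ha : redA1A2B1B2 ρ = A * Aᴴ := by
      ext p q
      simp [redA1A2B1B2, A, hw, mul_apply, vecMulVec_apply]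
    have hb : redE ρ = (Aᴴ * A)ᵀ := by
      ext p q
      simp [redE, A, hw, mul_apply, vecMulVec_apply, Fintype.sum_prod_type, mul_comm]
    rw [ha, hb, vnEntropy_complement]
  -- complementary subsystems: `a1 a2 b2` and `b1 e`
  have h2 : vnEntropy (redA1A2B2 ρ) = vnEntropy (redB1E ρ) := by
    let A : Matrix (ι1 × ι2 × ι4) (ι3 × ιe) ℂ :=
      Matrix.of fun p x => w (p.1, p.2.1, x.1, p.2.2, x.2)
    have ha : redA1A2B2 ρ = A * Aᴴ := by
      ext p q
      simp [redA1A2B2, A, hw, mul_apply, vecMulVec_apply, Fintype.sum_prod_type]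
    have hb : redB1E ρ = (Aᴴ * A)ᵀ := by
      ext p q
      simp [redB1E, A, hw, mul_apply, vecMulVec_apply, Fintype.sum_prod_type, mul_comm]
    rw [ha, hb, vnEntropy_complement]
  have hA : (redA1B2 ρ).IsHermitian := by
    ext p q
    simp only [conjTranspose_apply, redA1B2, star_sum, hH]
  have hB : (redA2 ρ).IsHermitian := by
    ext p q
    simp only [conjTranspose_apply, redA2, star_sum, hH]
  have tr' : ∑ x1, ∑ x2, ∑ x3, ∑ x4, ∑ xe,
      ρ (x1, x2, x3, x4, xe) (x1, x2, x3, x4, xe) = 1 := by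
    rw [← htr]
    simp only [Matrix.trace, Fintype.sum_prod_type, diag_apply]
  have tA : (redA1B2 ρ).trace = 1 := by
    rw [← tr']
    simp only [Matrix.trace, Fintype.sum_prod_type, diag_apply, redA1B2]
    refine Finset.sum_congr rfl fun x1 _ => ?_
    rw [Finset.sum_comm]
    refine Finset.sum_congr rfl fun x2 _ => ?_
    rw [Finset.sum_comm]
  have tB : (redA2 ρ).trace = 1 := by
    rw [← tr']
    simp only [Matrix.trace, diag_apply, redA2]
    rw [Finset.sum_comm]
  have h3 : vnEntropy (redA1A2B2 ρ) = vnEntropy (redA1B2 ρ) + vnEntropy (redA2 ρ) := by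
    let e : (ι1 × ι4) × ι2 ≃ ι1 × ι2 × ι4 :=
      { toFun := fun p => (p.1.1, p.2, p.1.2)
        invFun := fun p => ((p.1, p.2.2), p.2.1)
        left_inv := fun _ => rfl
        right_inv := fun _ => rfl }
    have hK : (kroneckerMap (· * ·) (redA1B2 ρ) (redA2 ρ)).IsHermitian := by
      unfold Matrix.IsHermitian
      rw [conjTranspose_kronecker, hA.eq, hB.eq]
    have he : redA1A2B2 ρ
        = (kroneckerMap (· * ·) (redA1B2 ρ) (redA2 ρ)).submatrix e.symm e.symm := by
      ext ⟨x1, x2, x4⟩ ⟨y1, y2, y4⟩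
      exact hfact x1 y1 x2 y2 x4 y4
    rw [he, vnEntropy_reindex e _ hK, vnEntropy_kronecker _ _ hA hB tA tB]
  rw [h1, ← h3, h2]
  ring
end

section
/- Let ι_a, ι_b, ι_{e0}, ι_f be nonempty finite types and let ρ be a pure density matrix on the product type ι_a × ι_b × ι_{e0} × ι_f. Then S(ρ^{b}) − S(ρ^{a b}) ≤ S(ρ^{a e0}) − S(ρ^{e0}). Equivalently, writing I^{x}(ρ^{a x}) := S(ρ^{x}) − S(ρ^{a x}) for the coherent information toward x, one has I^{b}(ρ^{a b}) ≤ −I^{e0}(ρ^{a e0}). -/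
open Matrix ComplexOrder

section
/- Index types: positions are (a, b, e0, f). -/
variable {ιa ιb ιe ιf : Type*} [Fintype ιa] [Fintype ιb] [Fintype ιe] [Fintype ιf]

/-- Reduced density matrix on (b). -/
noncomputable def redB (ρ : Matrix (ιa × ιb × ιe × ιf) (ιa × ιb × ιe × ιf) ℂ) :
    Matrix ιb ιb ℂ :=
  fun p q => ∑ x1 : ιa, ∑ x3 : ιe, ∑ x4 : ιf, ρ (x1, p, x3, x4) (x1, q, x3, x4)

/-- Reduced density matrix on (a, b). -/
noncomputable def redAB (ρ : Matrix (ιa × ιb × ιe × ιf) (ιa × ιb × ιe × ιf) ℂ) :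
    Matrix (ιa × ιb) (ιa × ιb) ℂ :=
  fun p q => ∑ x3 : ιe, ∑ x4 : ιf, ρ (p.1, p.2, x3, x4) (q.1, q.2, x3, x4)

/-- Reduced density matrix on (a, e0). -/
noncomputable def redAE0 (ρ : Matrix (ιa × ιb × ιe × ιf) (ιa × ιb × ιe × ιf) ℂ) :
    Matrix (ιa × ιe) (ιa × ιe) ℂ :=
  fun p q => ∑ x2 : ιb, ∑ x4 : ιf, ρ (p.1, x2, p.2, x4) (q.1, x2, q.2, x4)

/-- Reduced density matrix on (e0). -/
noncomputable def redE0 (ρ : Matrix (ιa × ιb × ιe × ιf) (ιa × ιb × ιe × ιf) ℂ) :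
    Matrix ιe ιe ℂ :=
  fun p q => ∑ x1 : ιa, ∑ x2 : ιb, ∑ x4 : ιf, ρ (x1, x2, p, x4) (x1, x2, q, x4)

end


namespace SSA

noncomputable def Phi {n : Type*} [Fintype n] (s : ℝ) (A B X : Matrix n n ℂ) : ℝ :=
  2 * (trace (Xᴴ * A)).re - (trace (Xᴴ * X * B)).re - s * (trace (X * Xᴴ * A)).re

lemma Phi_eq {n : Type*} [Fintype n] [DecidableEq n] (s : ℝ) (U V Z : Matrix n n ℂ) (a b : n → ℝ)
    (hU : Uᴴ * U = 1) (hV : Vᴴ * V = 1) :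
    Phi s (U * diagonal (fun i => (a i : ℂ)) * Uᴴ) (V * diagonal (fun i => (b i : ℂ)) * Vᴴ)
      (U * Z * Vᴴ) = ∑ i, ∑ j, (2 * (a i * (star (Z i j) * (Uᴴ * V) i j).re)
        - (b j + s * a i) * ‖Z i j‖ ^ 2) := by
  have h1 : trace ((U * Z * Vᴴ)ᴴ * (U * diagonal (fun i => (a i : ℂ)) * Uᴴ))
      = ∑ i, ∑ j, (a i : ℂ) * (star (Z i j) * (Uᴴ * V) i j) := by
    have : (U * Z * Vᴴ)ᴴ * (U * diagonal (fun i => (a i : ℂ)) * Uᴴ)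
        = V * (Zᴴ * diagonal (fun i => (a i : ℂ)) * Uᴴ) := by
      simp only [conjTranspose_mul, conjTranspose_conjTranspose]
      calc _ = V * Zᴴ * (Uᴴ * U) * diagonal (fun i => (a i : ℂ)) * Uᴴ := by
            simp only [Matrix.mul_assoc]
        _ = _ := by rw [hU]; simp only [Matrix.mul_assoc, Matrix.one_mul]
    rw [this, trace_mul_comm, Matrix.mul_assoc, trace]
    rw [Finset.sum_comm]
    refine Finset.sum_congr rfl fun j _ => ?_
    rw [diag_apply, Matrix.mul_apply]
    refine Finset.sum_congr rfl fun i _ => ?_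
    rw [mul_diagonal, conjTranspose_apply]
    ring
  have hn : ∀ z : ℂ, star z * z = ((‖z‖ ^ 2 : ℝ) : ℂ) := by
    intro z
    rw [Complex.star_def, Complex.conj_mul']; push_cast; rfl
  have h2 : trace ((U * Z * Vᴴ)ᴴ * (U * Z * Vᴴ) * (V * diagonal (fun i => (b i : ℂ)) * Vᴴ))
      = ((∑ i, ∑ j, b j * ‖Z i j‖ ^ 2 : ℝ) : ℂ) := by
    have : (U * Z * Vᴴ)ᴴ * (U * Z * Vᴴ) * (V * diagonal (fun i => (b i : ℂ)) * Vᴴ)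
        = V * (Zᴴ * Z * diagonal (fun i => (b i : ℂ)) * Vᴴ) := by
      simp only [conjTranspose_mul, conjTranspose_conjTranspose]
      calc _ = V * Zᴴ * (Uᴴ * U) * Z * (Vᴴ * V) * diagonal (fun i => (b i : ℂ)) * Vᴴ := by
            simp only [Matrix.mul_assoc]
        _ = _ := by rw [hU, hV]; simp only [Matrix.mul_assoc, Matrix.one_mul]
    rw [this, trace_mul_comm, Matrix.mul_assoc, hV, Matrix.mul_one, trace]
    push_cast
    rw [Finset.sum_comm]
    refine Finset.sum_congr rfl fun j _ => ?_
    rw [diag_apply, mul_diagonal, Matrix.mul_apply, Finset.sum_mul]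
    refine Finset.sum_congr rfl fun i _ => ?_
    rw [conjTranspose_apply, hn]
    push_cast; ring
  have h3 : trace ((U * Z * Vᴴ) * (U * Z * Vᴴ)ᴴ * (U * diagonal (fun i => (a i : ℂ)) * Uᴴ))
      = ((∑ i, ∑ j, a i * ‖Z i j‖ ^ 2 : ℝ) : ℂ) := by
    have : (U * Z * Vᴴ) * (U * Z * Vᴴ)ᴴ * (U * diagonal (fun i => (a i : ℂ)) * Uᴴ)
        = U * (Z * Zᴴ * diagonal (fun i => (a i : ℂ)) * Uᴴ) := by
      simp only [conjTranspose_mul, conjTranspose_conjTranspose]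
      calc _ = U * Z * (Vᴴ * V) * Zᴴ * (Uᴴ * U) * diagonal (fun i => (a i : ℂ)) * Uᴴ := by
            simp only [Matrix.mul_assoc]
        _ = _ := by rw [hU, hV]; simp only [Matrix.mul_assoc, Matrix.one_mul]
    rw [this, trace_mul_comm, Matrix.mul_assoc, hU, Matrix.mul_one, trace]
    push_cast
    refine Finset.sum_congr rfl fun j _ => ?_
    rw [diag_apply, mul_diagonal, Matrix.mul_apply, Finset.sum_mul]
    refine Finset.sum_congr rfl fun i _ => ?_
    rw [conjTranspose_apply, mul_comm (Z j i), hn]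
    push_cast; ring
  rw [Phi, h1, h2, h3]
  simp only [Complex.re_sum, Complex.ofReal_re, Complex.re_ofReal_mul, Finset.mul_sum,
    ← Finset.sum_sub_distrib]
  refine Finset.sum_congr rfl fun i _ => Finset.sum_congr rfl fun j _ => ?_
  ring

lemma Phi_le {n : Type*} [Fintype n] [DecidableEq n] (s : ℝ) (hs : 0 < s) (U V X : Matrix n n ℂ)
    (a b : n → ℝ) (ha : ∀ i, 0 ≤ a i) (hb : ∀ i, 0 ≤ b i)
    (hU : Uᴴ * U = 1) (hV : Vᴴ * V = 1) :
    Phi s (U * diagonal (fun i => (a i : ℂ)) * Uᴴ) (V * diagonal (fun i => (b i : ℂ)) * Vᴴ) X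
      ≤ ∑ i, ∑ j, a i * ‖(Uᴴ * V) i j‖ ^ 2 * (a i / (b j + s * a i)) := by
  have hU' := mul_eq_one_comm.mp hU
  have hV' := mul_eq_one_comm.mp hV
  have hX : X = U * (Uᴴ * X * V) * Vᴴ := by
    calc X = (U * Uᴴ) * X * (V * Vᴴ) := by rw [hU', hV']; simp
      _ = _ := by simp only [Matrix.mul_assoc]
  rw [hX, Phi_eq s U V _ a b hU hV]
  refine Finset.sum_le_sum fun i _ => Finset.sum_le_sum fun j _ => ?_
  generalize (Uᴴ * X * V) i j = z
  generalize (Uᴴ * V) i j = w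
  have hre : (star z * w).re ≤ ‖z‖ * ‖w‖ := by
    calc _ ≤ ‖star z * w‖ := Complex.re_le_norm _
      _ = _ := by rw [norm_mul, norm_star]
  have h1 := mul_le_mul_of_nonneg_left hre (ha i)
  rcases (ha i).eq_or_lt with h0 | h0
  · rw [← h0]
    have := mul_nonneg (hb j) (sq_nonneg ‖z‖)
    simp only [zero_mul, mul_zero, add_zero]; linarith
  · have hd : 0 < b j + s * a i := by have := hb j; positivity
    have : a i * ‖w‖ ^ 2 * (a i / (b j + s * a i)) = (a i * ‖w‖) ^ 2 / (b j + s * a i) := by ring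
    rw [this, le_div_iff₀ hd]
    nlinarith [sq_nonneg ((b j + s * a i) * ‖z‖ - a i * ‖w‖)]

lemma Phi_attained {n : Type*} [Fintype n] [DecidableEq n] (s : ℝ) (hs : 0 < s)
    (U V : Matrix n n ℂ)
    (a b : n → ℝ) (ha : ∀ i, 0 ≤ a i) (hb : ∀ i, 0 ≤ b i)
    (hU : Uᴴ * U = 1) (hV : Vᴴ * V = 1) : ∃ X,
    Phi s (U * diagonal (fun i => (a i : ℂ)) * Uᴴ) (V * diagonal (fun i => (b i : ℂ)) * Vᴴ) X
      = ∑ i, ∑ j, a i * ‖(Uᴴ * V) i j‖ ^ 2 * (a i / (b j + s * a i)) := by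
  refine ⟨U * (Matrix.of fun i j => ((a i / (b j + s * a i) : ℝ) : ℂ) * (Uᴴ * V) i j) * Vᴴ, ?_⟩
  rw [Phi_eq s U V _ a b hU hV]
  refine Finset.sum_congr rfl fun i _ => Finset.sum_congr rfl fun j _ => ?_
  simp only [of_apply]
  generalize (Uᴴ * V) i j = w
  have : (star (((a i / (b j + s * a i) : ℝ) : ℂ) * w) * w).re
      = (a i / (b j + s * a i)) * ‖w‖ ^ 2 := by
    rw [star_mul', mul_assoc, Complex.star_def, Complex.conj_mul',
      Complex.conj_ofReal, Complex.re_ofReal_mul]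
    norm_cast
  rw [this, norm_mul, Complex.norm_real, mul_pow, Real.norm_eq_abs, sq_abs]
  rcases (ha i).eq_or_lt with h0 | h0
  · rw [← h0]; simp
  · have hd : 0 < b j + s * a i := by have := hb j; positivity
    field_simp; ring

/-- sum side -/
noncomputable def G {n : Type*} [Fintype n] (a b : n → ℝ) (c : n → n → ℝ) (s : ℝ) : ℝ :=
  ∑ i, ∑ j, c i j * (Real.log (b j + s * a i) - Real.log (a i))

lemma G_deriv {n : Type*} [Fintype n] (a b : n → ℝ) (c : n → n → ℝ)
    (ha : ∀ i, 0 ≤ a i) (hb : ∀ i, 0 ≤ b i) (hca : ∀ i j, a i = 0 → c i j = 0)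
    (hcb : ∀ i j, b j = 0 → c i j = 0) (s : ℝ) (hs : 0 ≤ s) :
    HasDerivAt (G a b c) (∑ i, ∑ j, c i j * (a i / (b j + s * a i))) s := by
  unfold G
  refine HasDerivAt.fun_sum fun i _ => HasDerivAt.fun_sum fun j _ => ?_
  by_cases hc : c i j = 0
  · simp only [hc, zero_mul]; exact hasDerivAt_const _ _
  · have h2 : 0 < b j := (hb j).lt_of_ne fun h => hc (hcb i j h.symm)
    have h3 : b j + s * a i ≠ 0 := by have := ha i; positivity
    have h4 : HasDerivAt (fun s => b j + s * a i) (a i) s := by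
      simpa using ((hasDerivAt_id s).mul_const (a i)).const_add (b j)
    exact ((h4.log h3).sub_const _).const_mul _

lemma G_lim {n : Type*} [Fintype n] (a b : n → ℝ) (c : n → n → ℝ)
    (ha : ∀ i, 0 ≤ a i) (hb : ∀ i, 0 ≤ b i) (hca : ∀ i j, a i = 0 → c i j = 0) :
    Filter.Tendsto (fun s => G a b c s - (∑ i, ∑ j, c i j) * Real.log s) Filter.atTop (nhds 0) := by
  have h : (0:ℝ) = ∑ i : n, ∑ j : n, 0 := by simp
  have e : (fun s => G a b c s - (∑ i, ∑ j, c i j) * Real.log s) = fun s => ∑ i, ∑ j,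
      c i j * (Real.log (b j + s * a i) - Real.log (a i) - Real.log s) := by
    funext s
    simp only [G, Finset.sum_mul, ← Finset.sum_sub_distrib]
    refine Finset.sum_congr rfl fun i _ => Finset.sum_congr rfl fun j _ => ?_
    ring
  rw [e, h]
  refine tendsto_finsetSum _ fun i _ => tendsto_finsetSum _ fun j _ => ?_
  rcases (ha i).eq_or_lt with h0 | h0
  · simp only [hca i j h0.symm, zero_mul]; exact tendsto_const_nhds
  · have h1 : Filter.Tendsto (fun s : ℝ => b j / a i * s⁻¹ + 1) Filter.atTop (nhds 1) := by
      simpa using (tendsto_inv_atTop_zero.const_mul (b j / a i)).add_const (1:ℝ)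
    have h2 := (h1.log one_ne_zero).const_mul (c i j)
    rw [Real.log_one, mul_zero] at h2
    refine h2.congr' ?_
    filter_upwards [Filter.eventually_gt_atTop 0] with s hs
    have hb' := hb j
    have h5 : b j + s * a i ≠ 0 := by positivity
    rw [← Real.log_div h5 h0.ne', ← Real.log_div (by positivity) hs.ne']
    congr 2
    field_simp

lemma main_mono {n m : Type*} [Fintype n] [DecidableEq n] [Fintype m] [DecidableEq m]
    (U V : Matrix n n ℂ) (a b : n → ℝ) (ha : ∀ i, 0 ≤ a i) (hb : ∀ i, 0 ≤ b i)
    (hU : Uᴴ * U = 1) (hV : Vᴴ * V = 1)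
    (U' V' : Matrix m m ℂ) (a' b' : m → ℝ) (ha' : ∀ i, 0 ≤ a' i) (hb' : ∀ i, 0 ≤ b' i)
    (hU' : U'ᴴ * U' = 1) (hV' : V'ᴴ * V' = 1)
    (hs : ∀ i j, b j = 0 → a i * ‖(Uᴴ * V) i j‖ ^ 2 = 0)
    (hs' : ∀ i j, b' j = 0 → a' i * ‖(U'ᴴ * V') i j‖ ^ 2 = 0)
    (hsum : ∑ i, ∑ j, a i * ‖(Uᴴ * V) i j‖ ^ 2 = ∑ i, ∑ j, a' i * ‖(U'ᴴ * V') i j‖ ^ 2)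
    (L : Matrix m m ℂ → Matrix n n ℂ) (hL : ∀ X Y, L (X * Y) = L X * L Y)
    (hLs : ∀ X, L Xᴴ = (L X)ᴴ)
    (hA : ∀ X, trace (L X * (U * diagonal (fun i => (a i : ℂ)) * Uᴴ))
        = trace (X * (U' * diagonal (fun i => (a' i : ℂ)) * U'ᴴ)))
    (hB : ∀ X, trace (L X * (V * diagonal (fun i => (b i : ℂ)) * Vᴴ))
        = trace (X * (V' * diagonal (fun i => (b' i : ℂ)) * V'ᴴ))) :
    ∑ i, ∑ j, a i * ‖(Uᴴ * V) i j‖ ^ 2 * (Real.log (b j) - Real.log (a i))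
    ≤ ∑ i, ∑ j, a' i * ‖(U'ᴴ * V') i j‖ ^ 2 * (Real.log (b' j) - Real.log (a' i)) := by
  set c := fun i j => a i * ‖(Uᴴ * V) i j‖ ^ 2 with hc
  set c' := fun i j => a' i * ‖(U'ᴴ * V') i j‖ ^ 2 with hc'
  have hca : ∀ i j, a i = 0 → c i j = 0 := fun i j h => by simp [hc, h]
  have hca' : ∀ i j, a' i = 0 → c' i j = 0 := fun i j h => by simp [hc', h]
  have hd : ∀ s, 0 ≤ s → HasDerivAt (fun s => G a b c s - G a' b' c' s) _ s := fun s h0 =>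
    (G_deriv a b c ha hb hca hs s h0).fun_sub (G_deriv a' b' c' ha' hb' hca' hs' s h0)
  have hm : MonotoneOn (fun s => G a b c s - G a' b' c' s) (Set.Ici 0) := by
    refine monotoneOn_of_deriv_nonneg (convex_Ici 0)
      (fun s h0 => (hd s h0).continuousAt.continuousWithinAt) ?_ ?_
    · intro s h0
      rw [interior_Ici] at h0
      exact (hd s (le_of_lt h0)).differentiableAt.differentiableWithinAt
    · intro s h0
      rw [interior_Ici] at h0
      rw [(hd s (le_of_lt h0)).deriv, sub_nonneg]
      obtain ⟨Y, hY⟩ := Phi_attained s h0 U' V' a' b' ha' hb' hU' hV'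
      refine hY.symm.le.trans (le_trans (le_of_eq ?_) (Phi_le s h0 U V (L Y) a b ha hb hU hV))
      simp only [Phi, ← hLs, ← hL, hA, hB]
  have hl : Filter.Tendsto (fun s => G a b c s - G a' b' c' s) Filter.atTop (nhds 0) := by
    have := (G_lim a b c ha hb hca).sub (G_lim a' b' c' ha' hb' hca')
    rw [sub_zero] at this
    refine this.congr fun s => ?_
    have hsum' : ∑ i, ∑ j, c i j = ∑ i, ∑ j, c' i j := hsum
    rw [hsum']; ring
  have h0 : G a b c 0 - G a' b' c' 0 ≤ 0 := by
    refine ge_of_tendsto hl ?_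
    filter_upwards [Filter.eventually_ge_atTop 0] with s hs
    exact hm (Set.mem_Ici.2 le_rfl) hs hs
  simp only [G, zero_mul, add_zero] at h0
  linarith


/-- Partial trace over the second factor. -/
noncomputable def ptr {p c : Type*} [Fintype c] (A : Matrix (p × c) (p × c) ℂ) : Matrix p p ℂ :=
  fun i j => ∑ k, A (i, k) (j, k)

lemma ptr_posSemidef {p c : Type*} [Fintype p] [Fintype c] {A : Matrix (p × c) (p × c) ℂ}
    (hA : A.PosSemidef) : (ptr A).PosSemidef := by
  have : ptr A = ∑ k : c, A.submatrix (fun i : p => (i, k)) (fun i : p => (i, k)) := by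
    ext i j; simp [ptr, Matrix.sum_apply]
  rw [this]
  exact posSemidef_sum _ fun k _ => hA.submatrix _

lemma spec {n : Type*} [Fintype n] [DecidableEq n] {A : Matrix n n ℂ} (hA : A.PosSemidef) :
    ∃ (U : Matrix n n ℂ) (a : n → ℝ), (∀ i, 0 ≤ a i) ∧ Uᴴ * U = 1 ∧
      A = U * diagonal (fun i => (a i : ℂ)) * Uᴴ ∧
      vnEntropy A = ∑ i, Real.negMulLog (a i) := by
  refine ⟨hA.1.eigenvectorUnitary, hA.1.eigenvalues, hA.eigenvalues_nonneg, ?_, ?_, ?_⟩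
  · rw [← star_eq_conjTranspose]; exact Unitary.coe_star_mul_self _
  · have := hA.1.spectral_theorem
    rw [Unitary.conjStarAlgAut_apply] at this
    exact this
  · rw [vnEntropy, dif_pos hA.1]

lemma diag_form {n : Type*} [Fintype n] [DecidableEq n] (U V : Matrix n n ℂ) (a : n → ℝ) (j : n) :
    (Vᴴ * (U * diagonal (fun i => (a i : ℂ)) * Uᴴ) * V) j j
      = ((∑ i, a i * ‖(Uᴴ * V) i j‖ ^ 2 : ℝ) : ℂ) := by
  have : Vᴴ * (U * diagonal (fun i => (a i : ℂ)) * Uᴴ) * V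
      = (Uᴴ * V)ᴴ * (diagonal (fun i => (a i : ℂ)) * (Uᴴ * V)) := by
    simp only [conjTranspose_mul, conjTranspose_conjTranspose, Matrix.mul_assoc]
  rw [this, Matrix.mul_apply]
  push_cast
  refine Finset.sum_congr rfl fun i _ => ?_
  rw [diagonal_mul, conjTranspose_apply, Complex.star_def, mul_left_comm, Complex.conj_mul']

lemma row_sum {n : Type*} [Fintype n] [DecidableEq n] (U V : Matrix n n ℂ)
    (hU : Uᴴ * U = 1) (hV : Vᴴ * V = 1) (i : n) : ∑ j, ‖(Uᴴ * V) i j‖ ^ 2 = 1 := by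
  have h : (Uᴴ * V) * (Uᴴ * V)ᴴ = 1 := by
    rw [conjTranspose_mul, conjTranspose_conjTranspose]
    calc _ = Uᴴ * (V * Vᴴ) * U := by simp only [Matrix.mul_assoc]
      _ = 1 := by rw [mul_eq_one_comm.mp hV, Matrix.mul_one, hU]
  have h2 := congrFun (congrFun h i) i
  rw [Matrix.mul_apply, one_apply_eq] at h2
  simp only [conjTranspose_apply, Complex.star_def, Complex.mul_conj'] at h2
  exact_mod_cast h2

open Kronecker in
lemma cond {p c : Type*} [Fintype p] [Fintype c] [DecidableEq p] [DecidableEq c]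
    {A : Matrix (p × c) (p × c) ℂ} (hA : A.PosSemidef) :
    ∃ (U V : Matrix (p × c) (p × c) ℂ) (a b : p × c → ℝ), (∀ i, 0 ≤ a i) ∧ (∀ i, 0 ≤ b i) ∧
      Uᴴ * U = 1 ∧ Vᴴ * V = 1 ∧
      A = U * diagonal (fun i => (a i : ℂ)) * Uᴴ ∧
      ptr A ⊗ₖ (1 : Matrix c c ℂ) = V * diagonal (fun i => (b i : ℂ)) * Vᴴ ∧
      (∀ i j, b j = 0 → a i * ‖(Uᴴ * V) i j‖ ^ 2 = 0) ∧
      (((∑ i, ∑ j, a i * ‖(Uᴴ * V) i j‖ ^ 2 : ℝ) : ℂ) = trace A) ∧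
      ∑ i, ∑ j, a i * ‖(Uᴴ * V) i j‖ ^ 2 * (Real.log (b j) - Real.log (a i))
        = vnEntropy A - vnEntropy (ptr A) := by
  obtain ⟨U, a, ha, hU, hAU, hSA⟩ := spec hA
  obtain ⟨V0, b0, hb0, hV0, hAV, hSB⟩ := spec (ptr_posSemidef hA)
  have hV : (V0 ⊗ₖ (1 : Matrix c c ℂ))ᴴ * (V0 ⊗ₖ (1 : Matrix c c ℂ)) = 1 := by
    rw [conjTranspose_kronecker, ← mul_kronecker_mul, hV0]; simp
  have h4 : ∀ j, ∑ k, ∑ i, a i * ‖(Uᴴ * (V0 ⊗ₖ (1 : Matrix c c ℂ))) i (j, k)‖ ^ 2 = b0 j := by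
    intro j
    have e1 : (V0ᴴ * ptr A * V0) j j = b0 j := by
      rw [hAV]
      have : V0ᴴ * (V0 * diagonal (fun i => (b0 i : ℂ)) * V0ᴴ) * V0
        = (V0ᴴ * V0) * diagonal (fun i => (b0 i : ℂ)) * (V0ᴴ * V0) := by
        simp only [Matrix.mul_assoc]
      rw [this, hV0]; simp
    have e2 : ∑ k, ((V0 ⊗ₖ (1 : Matrix c c ℂ))ᴴ * A * (V0 ⊗ₖ (1 : Matrix c c ℂ))) (j, k) (j, k)
        = (V0ᴴ * ptr A * V0) j j := by
      simp only [Matrix.mul_apply, ptr, Fintype.sum_prod_type, kroneckerMap_apply,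
        conjTranspose_apply, one_apply, mul_ite, mul_one, mul_zero, star_zero,
        ite_mul, zero_mul, Finset.sum_ite_eq', Finset.mem_univ, if_true,
        apply_ite star, Finset.mul_sum, Finset.sum_mul]
      rw [Finset.sum_comm]
      refine Finset.sum_congr rfl fun x _ => ?_
      rw [Finset.sum_comm]
    rw [e1] at e2
    rw [hAU] at e2
    simp only [diag_form] at e2
    exact_mod_cast e2
  have hnn : ∀ i j, 0 ≤ a i * ‖(Uᴴ * (V0 ⊗ₖ (1 : Matrix c c ℂ))) i j‖ ^ 2 := fun i j =>
    mul_nonneg (ha i) (sq_nonneg _)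
  refine ⟨U, V0 ⊗ₖ 1, a, fun q => b0 q.1, ha, fun q => hb0 _, hU, hV, hAU, ?_, ?_, ?_, ?_⟩
  · have : diagonal (fun q : p × c => (b0 q.1 : ℂ)) = diagonal (fun i => (b0 i : ℂ)) ⊗ₖ
      (1 : Matrix c c ℂ) := by
      rw [← diagonal_one, diagonal_kronecker_diagonal]; simp
    rw [this, conjTranspose_kronecker, ← mul_kronecker_mul, ← mul_kronecker_mul, ← hAV]; simp
  · rintro i ⟨j, k⟩ h
    have h5 := h4 j
    rw [show b0 j = 0 from h] at h5
    rw [Finset.sum_eq_zero_iff_of_nonneg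
      (fun k _ => Finset.sum_nonneg fun i _ => hnn i (j, k))] at h5
    have h6 := h5 k (Finset.mem_univ _)
    rw [Finset.sum_eq_zero_iff_of_nonneg (fun i _ => hnn i (j, k))] at h6
    exact h6 i (Finset.mem_univ _)
  · simp only [← Finset.mul_sum, row_sum U _ hU hV, mul_one]
    rw [hAU, trace_mul_comm, ← Matrix.mul_assoc, hU, Matrix.one_mul, trace_diagonal]
    push_cast; rfl
  · simp only [mul_sub, Finset.sum_sub_distrib]
    have t2 : ∑ i, ∑ j, a i * ‖(Uᴴ * (V0 ⊗ₖ (1 : Matrix c c ℂ))) i j‖ ^ 2 * Real.log (a i)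
        = - vnEntropy A := by
      simp only [← Finset.sum_mul, ← Finset.mul_sum, row_sum U _ hU hV, mul_one]
      rw [hSA, ← Finset.sum_neg_distrib]
      exact Finset.sum_congr rfl fun i _ => by rw [Real.negMulLog]; ring
    have t1 : ∑ i, ∑ j, a i * ‖(Uᴴ * (V0 ⊗ₖ (1 : Matrix c c ℂ))) i j‖ ^ 2 * Real.log (b0 j.1)
        = - vnEntropy (ptr A) := by
      rw [Finset.sum_comm, Fintype.sum_prod_type]
      simp only [← Finset.sum_mul]
      rw [hSB, ← Finset.sum_neg_distrib]
      refine Finset.sum_congr rfl fun j _ => ?_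
      rw [h4, Real.negMulLog]; ring
    rw [t1, t2]; ring

/-- Partial trace over the first factor of `(x × e) × f`. -/
noncomputable def ptr1 {x e f : Type*} [Fintype x]
    (A : Matrix ((x × e) × f) ((x × e) × f) ℂ) : Matrix (e × f) (e × f) ℂ :=
  fun p q => ∑ k, A ((k, p.1), p.2) ((k, q.1), q.2)

lemma ptr1_posSemidef {x e f : Type*} [Fintype x] [Fintype e] [Fintype f]
    {A : Matrix ((x × e) × f) ((x × e) × f) ℂ}
    (hA : A.PosSemidef) : (ptr1 A).PosSemidef := by
  have : ptr1 A = ∑ k : x, A.submatrix (fun p : e × f => ((k, p.1), p.2))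
      (fun p : e × f => ((k, p.1), p.2)) := by
    ext i j; simp [ptr1, Matrix.sum_apply]
  rw [this]
  exact posSemidef_sum _ fun k _ => hA.submatrix _

open Kronecker in
/-- Strong subadditivity. -/
lemma ssa {x e f : Type*} [Fintype x] [Fintype e] [Fintype f] [DecidableEq x] [DecidableEq e]
    [DecidableEq f] {A : Matrix ((x × e) × f) ((x × e) × f) ℂ} (hA : A.PosSemidef) :
    vnEntropy A - vnEntropy (ptr A) ≤ vnEntropy (ptr1 A) - vnEntropy (ptr (ptr1 A)) := by
  obtain ⟨U, V, a, b, ha, hb, hU, hV, h1, h2, h3, h4, h5⟩ := cond hA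
  obtain ⟨U', V', a', b', ha', hb', hU', hV', h1', h2', h3', h4', h5'⟩ := cond (ptr1_posSemidef hA)
  rw [← h5, ← h5']
  let L : Matrix (e × f) (e × f) ℂ → Matrix ((x × e) × f) ((x × e) × f) ℂ := fun Y =>
    ((1 : Matrix x x ℂ) ⊗ₖ Y).submatrix (Equiv.prodAssoc x e f) (Equiv.prodAssoc x e f)
  have htr : ∀ (Y : Matrix (e × f) (e × f) ℂ) (M : Matrix ((x × e) × f) ((x × e) × f) ℂ),
      trace (L Y * M) = trace (Y * ptr1 M) := by
    intro Y M
    simp only [L, trace, diag_apply, Matrix.mul_apply, submatrix_apply, kroneckerMap_apply,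
      Equiv.prodAssoc_apply, Fintype.sum_prod_type, one_apply, ite_mul, one_mul, zero_mul, ptr1,
      Finset.mul_sum]
    have : ∀ (x1 : x) (e1 : e) (f1 : f), (∑ x2 : x, ∑ e2 : e, ∑ f2 : f,
        if x1 = x2 then Y (e1, f1) (e2, f2) * M ((x2, e2), f2) ((x1, e1), f1) else 0)
        = ∑ e2 : e, ∑ f2 : f, Y (e1, f1) (e2, f2) * M ((x1, e2), f2) ((x1, e1), f1) := by
      intro x1 e1 f1
      rw [Finset.sum_eq_single x1]
      · simp
      · intro x2 _ h; simp [h.symm]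
      · simp
    simp only [this]
    rw [Finset.sum_comm]
    refine Finset.sum_congr rfl fun e1 _ => ?_
    rw [Finset.sum_comm]
    refine Finset.sum_congr rfl fun f1 _ => ?_
    rw [Finset.sum_comm]
    refine Finset.sum_congr rfl fun e2 _ => ?_
    rw [Finset.sum_comm]
  refine main_mono U V a b ha hb hU hV U' V' a' b' ha' hb' hU' hV' h3 h3' ?_ L ?_ ?_ ?_ ?_
  · have : trace A = trace (ptr1 A) := by
      have h := htr 1 A
      simpa [L] using h
    rw [← h4, ← h4'] at this
    exact_mod_cast this
  · intro X Y
    simp only [L]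
    rw [submatrix_mul_equiv, ← mul_kronecker_mul, Matrix.one_mul]
  · intro X
    simp only [L]
    rw [conjTranspose_submatrix, conjTranspose_kronecker, conjTranspose_one]
  · intro X
    rw [← h1, ← h1', htr]
  · intro X
    rw [← h2, ← h2', htr]
    congr 2
    ext p q
    simp only [ptr1, ptr, kroneckerMap_apply, Finset.sum_mul]
    rw [Finset.sum_comm]

lemma vnEntropy_eq_roots {n : Type*} [Fintype n] [DecidableEq n] {A : Matrix n n ℂ}
    (hA : A.IsHermitian) :
    vnEntropy A = (A.charpoly.roots.map fun z : ℂ => Real.negMulLog z.re).sum := by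
  rw [vnEntropy, dif_pos hA, hA.roots_charpoly_eq_eigenvalues, Multiset.map_map]
  rfl

/-- Complementary reductions of a pure state have equal entropy. -/
lemma vnEntropy_compl {m n : Type*} [Fintype n] [DecidableEq n] [Fintype m] [DecidableEq m]
    (N : Matrix m n ℂ) : vnEntropy (N * Nᴴ) = vnEntropy (Nᵀ * Nᵀᴴ) := by
  rw [vnEntropy_eq_roots (isHermitian_mul_conjTranspose_self N),
    vnEntropy_eq_roots (isHermitian_mul_conjTranspose_self Nᵀ)]
  have e : (Nᵀ * Nᵀᴴ).charpoly = (Nᴴ * N).charpoly := by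
    rw [← charpoly_transpose (Nᴴ * N), transpose_mul]; rfl
  rw [e]
  have h := congrArg (fun q : Polynomial ℂ => (q.roots.map fun z : ℂ => Real.negMulLog z.re).sum)
    (charpoly_mul_comm' N Nᴴ)
  have hx : ∀ (k : ℕ) (q : Polynomial ℂ), q.Monic →
      (((Polynomial.X ^ k * q).roots.map fun z : ℂ => Real.negMulLog z.re).sum)
      = (q.roots.map fun z : ℂ => Real.negMulLog z.re).sum := by
    intro k q hq
    rw [Polynomial.roots_mul (mul_ne_zero (pow_ne_zero _ Polynomial.X_ne_zero) hq.ne_zero)]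
    simp [Multiset.map_nsmul, Multiset.sum_nsmul]
  simp only [hx _ _ (charpoly_monic _)] at h
  exact h

end SSA




/-- **Composite step in the proof of Theorem 1 of the paper.** For a pure density matrix `ρ`
on `a × b × e0 × f`, the coherent information toward `b` is bounded by minus the coherent
information toward the environment subsystem `e0`:
`S(ρ^{b}) − S(ρ^{a b}) ≤ S(ρ^{a e0}) − S(ρ^{e0})`, i.e. `I^b(ρ^{ab}) ≤ −I^{e0}(ρ^{a e0})`. -/
theorem coherent_info_le_neg_env_coherent_info
    {ιa ιb ιe ιf : Type*} [Fintype ιa] [Fintype ιb] [Fintype ιe] [Fintype ιf]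
    [DecidableEq ιa] [DecidableEq ιb] [DecidableEq ιe] [DecidableEq ιf]
    [Nonempty ιa] [Nonempty ιb] [Nonempty ιe] [Nonempty ιf]
    (ρ : Matrix (ιa × ιb × ιe × ιf) (ιa × ιb × ιe × ιf) ℂ)
    (hpure : IsPureDensityMatrix ρ) :
    vnEntropy (redB ρ) - vnEntropy (redAB ρ)
      ≤ vnEntropy (redAE0 ρ) - vnEntropy (redE0 ρ) := by
  classical
  obtain ⟨-, w, -, rfl⟩ := hpure
  let N : Matrix ((ιa × ιe) × ιf) ιb ℂ := Matrix.of fun p b => w (p.1.1, b, p.1.2, p.2)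
  let N2 : Matrix (ιe × ιf) (ιa × ιb) ℂ := Matrix.of fun p q => w (q.1, q.2, p.1, p.2)
  have hA : (N * Nᴴ).PosSemidef := posSemidef_self_mul_conjTranspose N
  have h := SSA.ssa hA
  have e1 : redB (vecMulVec w (star w)) = Nᵀ * Nᵀᴴ := by
    ext p q
    simp [redB, N, Matrix.mul_apply, vecMulVec_apply, Fintype.sum_prod_type]
  have e2 : redAB (vecMulVec w (star w)) = N2ᵀ * N2ᵀᴴ := by
    ext p q
    simp [redAB, N2, Matrix.mul_apply, vecMulVec_apply, Fintype.sum_prod_type]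
  have e3 : SSA.ptr1 (N * Nᴴ) = N2 * N2ᴴ := by
    ext p q
    simp [SSA.ptr1, N, N2, Matrix.mul_apply, Fintype.sum_prod_type]
  have e4 : redAE0 (vecMulVec w (star w)) = SSA.ptr (N * Nᴴ) := by
    ext p q
    simp only [redAE0, SSA.ptr, N, of_apply, Matrix.mul_apply, vecMulVec_apply, conjTranspose_apply,
      Pi.star_apply]
    rw [Finset.sum_comm]
  have e5 : redE0 (vecMulVec w (star w)) = SSA.ptr (N2 * N2ᴴ) := by
    ext p q
    simp only [redE0, SSA.ptr, N2, of_apply, Matrix.mul_apply, vecMulVec_apply, conjTranspose_apply,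
      Pi.star_apply, Fintype.sum_prod_type]
    symm
    rw [Finset.sum_comm]
    refine Finset.sum_congr rfl fun x _ => ?_
    rw [Finset.sum_comm]
  rw [e3] at h
  rw [e1, e2, e4, e5, ← SSA.vnEntropy_compl, ← SSA.vnEntropy_compl]
  linarith
end
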